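/- arXiv:2410.22084 — 5 statements merged into one kernel-verified Lean document; each statement's English description precedes it below -/
import Mathlib

section
/- Let n ∈ ℕ and α : Fin n → ℝ with α j ∈ (−π, π) for all j. Suppose there is an involution σ : Fin n → Fin n (σ ∘ σ = id) such that α(σ j) = −α(j) for all j. Then −∑_{j} exp(i·α j) · log(exp(i·α j)) = ∑_{j} α j · sin(α j); in particular this sum is a nonnegative real number. -/
open Complex

/-- If the angles `α j ∈ (-π, π)` come in plus/minus pairs (via an involution `σ` with
`α (σ j) = -α j`), then the pseudo-entropy `-∑ exp(iαⱼ) log(exp(iαⱼ))` equals the real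
number `∑ αⱼ sin(αⱼ)`, which is nonnegative. -/
theorem pseudo_entropy_real_of_conj_spectrum (n : ℕ) (α : Fin n → ℝ)
    (hα : ∀ j, α j ∈ Set.Ioo (-Real.pi) Real.pi)
    (σ : Fin n → Fin n) (hσ : σ ∘ σ = id) (hanti : ∀ j, α (σ j) = -α j) :
    (-∑ j, Complex.exp ((α j : ℂ) * I) * Complex.log (Complex.exp ((α j : ℂ) * I)) =
        ((∑ j, α j * Real.sin (α j) : ℝ) : ℂ)) ∧
    0 ≤ ∑ j, α j * Real.sin (α j) := by
  have hlog : ∀ j, Complex.log (Complex.exp ((α j : ℂ) * I)) = (α j : ℂ) * I := by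
    intro j
    apply Complex.log_exp
    · simpa using (hα j).1
    · simpa using (hα j).2.le
  have hinv : Function.Involutive σ := fun j => congrFun hσ j
  have hcos : ∑ j, α j * Real.cos (α j) = 0 := by
    have h1 : ∑ j, α (σ j) * Real.cos (α (σ j)) = ∑ j, α j * Real.cos (α j) :=
      hinv.bijective.sum_comp (fun j => α j * Real.cos (α j))
    simp only [hanti, Real.cos_neg, neg_mul, Finset.sum_neg_distrib] at h1
    linarith
  constructor
  · have hterm : ∀ j, Complex.exp ((α j : ℂ) * I) * Complex.log (Complex.exp ((α j : ℂ) * I)) =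
        ((α j * Real.cos (α j) : ℝ) : ℂ) * I - ((α j * Real.sin (α j) : ℝ) : ℂ) := by
      intro j
      rw [hlog, Complex.exp_mul_I]
      push_cast
      linear_combination (Complex.sin (α j) * (α j : ℂ)) * Complex.I_mul_I
    rw [Finset.sum_congr rfl (fun j _ => hterm j), Finset.sum_sub_distrib, ← Finset.sum_mul,
      ← Complex.ofReal_sum, ← Complex.ofReal_sum, hcos]
    simp
  · apply Finset.sum_nonneg
    intro j _
    rcases le_total 0 (α j) with h | h
    · exact mul_nonneg h (Real.sin_nonneg_of_nonneg_of_le_pi h (hα j).2.le)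
    · exact mul_nonneg_of_nonpos_of_nonpos h
        (Real.sin_nonpos_of_nonpos_of_neg_pi_le h (hα j).1.le)
end

section
/- Let Λ₁ be an m×m complex diagonal matrix with diagonal entries exp(i·α_j), and Λ₂ an n×n complex diagonal matrix with diagonal entries exp(i·β_k), where all α_j, β_k, and all sums α_j + β_k lie in (−π, π). Define S(D) = −∑ over diagonal entries d of D of d·log(d), with log the principal branch. Then S(Λ₁ ⊗ Λ₂) = Tr(Λ₂)·S(Λ₁) + Tr(Λ₁)·S(Λ₂), where ⊗ denotes the Kronecker product. -/
open Matrix Kronecker Complex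

/-- The pseudo-entropy of a diagonal matrix: `S(D) = -∑ over diagonal entries d of d·log d`,
with `log` the principal branch of the complex logarithm. -/
noncomputable def pseudoEntropy {ι : Type*} [Fintype ι] (D : Matrix ι ι ℂ) : ℂ :=
  -∑ i, D i i * Complex.log (D i i)

/-- For diagonal matrices `Λ₁ = diag(exp(iαⱼ))` and `Λ₂ = diag(exp(iβₖ))` with all angles and
all sums of angles within the principal branch `(-π, π)`,
`S(Λ₁ ⊗ Λ₂) = Tr(Λ₂)·S(Λ₁) + Tr(Λ₁)·S(Λ₂)`. -/
theorem pseudoEntropy_kronecker (m n : ℕ) (α : Fin m → ℝ) (β : Fin n → ℝ)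
    (hα : ∀ j, α j ∈ Set.Ioo (-Real.pi) Real.pi)
    (hβ : ∀ k, β k ∈ Set.Ioo (-Real.pi) Real.pi)
    (hαβ : ∀ j k, α j + β k ∈ Set.Ioo (-Real.pi) Real.pi) :
    pseudoEntropy
        ((Matrix.diagonal fun j => Complex.exp ((α j : ℂ) * I)) ⊗ₖ
          (Matrix.diagonal fun k => Complex.exp ((β k : ℂ) * I))) =
      (Matrix.diagonal fun k => Complex.exp ((β k : ℂ) * I)).trace *
          pseudoEntropy (Matrix.diagonal fun j => Complex.exp ((α j : ℂ) * I)) +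
        (Matrix.diagonal fun j => Complex.exp ((α j : ℂ) * I)).trace *
          pseudoEntropy (Matrix.diagonal fun k => Complex.exp ((β k : ℂ) * I)) := by
  have hlog : ∀ x : ℝ, x ∈ Set.Ioo (-Real.pi) Real.pi →
      Complex.log (Complex.exp ((x : ℂ) * I)) = (x : ℂ) * I := by
    intro x hx
    apply Complex.log_exp
    · simpa using hx.1
    · simpa using hx.2.le
  have hmul : ∀ j k, Complex.exp ((α j : ℂ) * I) * Complex.exp ((β k : ℂ) * I) =
      Complex.exp (((α j + β k : ℝ) : ℂ) * I) := by
    intro j k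
    rw [← Complex.exp_add]
    push_cast
    ring_nf
  simp only [pseudoEntropy, Matrix.trace, Matrix.diag_apply, Matrix.kroneckerMap_apply,
    Matrix.diagonal_apply_eq, Fintype.sum_prod_type, hlog _ (hα _), hlog _ (hβ _)]
  have hterm : ∀ j k, Complex.exp ((α j : ℂ) * I) * Complex.exp ((β k : ℂ) * I) *
      Complex.log (Complex.exp ((α j : ℂ) * I) * Complex.exp ((β k : ℂ) * I)) =
      Complex.exp ((α j : ℂ) * I) * ((α j : ℂ) * I) * Complex.exp ((β k : ℂ) * I) +
      Complex.exp ((α j : ℂ) * I) * (Complex.exp ((β k : ℂ) * I) * ((β k : ℂ) * I)) := by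
    intro j k
    have h : Complex.log (Complex.exp ((α j : ℂ) * I) * Complex.exp ((β k : ℂ) * I)) =
        (α j : ℂ) * I + (β k : ℂ) * I := by
      rw [hmul, hlog _ (hαβ j k)]
      push_cast
      ring
    rw [h]
    ring
  simp only [hterm, Finset.sum_add_distrib, ← Finset.sum_mul_sum]
  ring
end

section
/- Let θ ∈ (−π, π) and let R_X(2θ) be the 2×2 matrix with rows (cos θ, −i sin θ) and (−i sin θ, cos θ). Then the characteristic polynomial of R_X(2θ) equals (X − e^{iθ})·(X − e^{−iθ}), and the pseudo-entropy −e^{iθ}·log(e^{iθ}) − e^{−iθ}·log(e^{−iθ}) equals 2θ·sin θ, which is a nonnegative real number. -/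
open Matrix Complex Polynomial

/-- For `θ ∈ (-π, π)`, the Pauli-X rotation `R_X(2θ)` with rows `(cos θ, -i sin θ)` and
`(-i sin θ, cos θ)` has characteristic polynomial `(X - e^{iθ})(X - e^{-iθ})`, and its
pseudo-entropy `-e^{iθ} log e^{iθ} - e^{-iθ} log e^{-iθ}` equals `2θ sin θ ≥ 0`. -/
theorem rx_charpoly_pseudoEntropy (θ : ℝ) (hθ : θ ∈ Set.Ioo (-Real.pi) Real.pi) :
    (!![(Real.cos θ : ℂ), -I * (Real.sin θ : ℂ);
        -I * (Real.sin θ : ℂ), (Real.cos θ : ℂ)]).charpoly =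
      (X - C (Complex.exp ((θ : ℂ) * I))) * (X - C (Complex.exp (-(θ : ℂ) * I))) ∧
    -Complex.exp ((θ : ℂ) * I) * Complex.log (Complex.exp ((θ : ℂ) * I)) -
        Complex.exp (-(θ : ℂ) * I) * Complex.log (Complex.exp (-(θ : ℂ) * I)) =
      ((2 * θ * Real.sin θ : ℝ) : ℂ) ∧
    0 ≤ 2 * θ * Real.sin θ := by
  have h1 : Complex.exp ((θ : ℂ) * I) = (Real.cos θ : ℂ) + (Real.sin θ : ℂ) * I := by
    rw [Complex.exp_mul_I]; push_cast; ring
  have h2 : Complex.exp (-(θ : ℂ) * I) = (Real.cos θ : ℂ) - (Real.sin θ : ℂ) * I := by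
    rw [Complex.exp_mul_I, Complex.cos_neg, Complex.sin_neg]; push_cast; ring
  obtain ⟨ha, hb⟩ := hθ
  refine ⟨?_, ?_, ?_⟩
  · rw [h1, h2, Matrix.charpoly, Matrix.det_fin_two]
    simp only [Matrix.charmatrix_apply, Matrix.of_apply, Matrix.cons_val', Matrix.cons_val_zero,
      Matrix.cons_val_one, Matrix.cons_val_fin_one, Matrix.diagonal_apply_eq, ne_eq,
      zero_ne_one, one_ne_zero, not_false_eq_true, Matrix.diagonal_apply_ne,
      map_add, map_sub, map_mul, map_neg]
    ring
  · have l1 : Complex.log (Complex.exp ((θ : ℂ) * I)) = (θ : ℂ) * I :=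
      Complex.log_exp (by simpa using ha) (by simpa using hb.le)
    have l2 : Complex.log (Complex.exp (-(θ : ℂ) * I)) = -(θ : ℂ) * I :=
      Complex.log_exp (by simpa using hb) (by simp; linarith)
    rw [l1, l2, h1, h2]
    push_cast
    linear_combination (-2 * (θ : ℂ) * Complex.sin θ) * Complex.I_sq
  · rcases le_total 0 θ with h | h
    · have := Real.sin_nonneg_of_nonneg_of_le_pi h hb.le
      positivity
    · have := Real.sin_nonpos_of_nonpos_of_neg_pi_le h ha.le
      nlinarith [mul_nonneg_of_nonpos_of_nonpos h this]
end

section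
/- Let θ ∈ ℝ and set c = cos(2θ). The Kronecker product R_X(2cos²θ) ⊗ R_X(2sin²θ) has characteristic polynomial (X − e^{i})·(X − e^{−i})·(X − e^{ic})·(X − e^{−ic}); moreover the pseudo-entropy over these four eigenvalues, −(e^{ic} log e^{ic} + e^{−ic} log e^{−ic} + e^{i} log e^{i} + e^{−i} log e^{−i}), equals 2·cos(2θ)·sin(cos(2θ)) + 2·sin(1). -/
open Matrix Kronecker Complex Polynomial

/-- The Pauli-X rotation gate `R_X(φ) = exp(-i(φ/2)X)`, with rows
`(cos(φ/2), -i sin(φ/2))` and `(-i sin(φ/2), cos(φ/2))`. -/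
noncomputable def RX (φ : ℝ) : Matrix (Fin 2) (Fin 2) ℂ :=
  !![(Real.cos (φ / 2) : ℂ), -I * (Real.sin (φ / 2) : ℂ);
     -I * (Real.sin (φ / 2) : ℂ), (Real.cos (φ / 2) : ℂ)]

theorem charpoly_kron_aux (a b d e : ℂ) :
    ((!![a, b; b, a] : Matrix (Fin 2) (Fin 2) ℂ) ⊗ₖ
      (!![d, e; e, d] : Matrix (Fin 2) (Fin 2) ℂ)).charpoly =
      (X - C ((a - b) * (d - e))) * (X - C ((a + b) * (d + e))) *
        (X - C ((a - b) * (d + e))) * (X - C ((a + b) * (d - e))) := by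
  rw [← Matrix.charpoly_reindex (finProdFinEquiv : Fin 2 × Fin 2 ≃ Fin 4)]
  have h : Matrix.reindex (finProdFinEquiv : Fin 2 × Fin 2 ≃ Fin 4) finProdFinEquiv
      ((!![a, b; b, a] : Matrix (Fin 2) (Fin 2) ℂ) ⊗ₖ
      (!![d, e; e, d] : Matrix (Fin 2) (Fin 2) ℂ)) =
      !![a * d, a * e, b * d, b * e; a * e, a * d, b * e, b * d;
         b * d, b * e, a * d, a * e; b * e, b * d, a * e, a * d] := by
    ext i j
    fin_cases i <;> fin_cases j <;> rfl
  have h2 : Matrix.charmatrix (!![a * d, a * e, b * d, b * e; a * e, a * d, b * e, b * d;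
         b * d, b * e, a * d, a * e; b * e, b * d, a * e, a * d] : Matrix (Fin 4) (Fin 4) ℂ) =
      !![X - C (a * d), -C (a * e), -C (b * d), -C (b * e);
         -C (a * e), X - C (a * d), -C (b * e), -C (b * d);
         -C (b * d), -C (b * e), X - C (a * d), -C (a * e);
         -C (b * e), -C (b * d), -C (a * e), X - C (a * d)] := by
    ext1 i j
    fin_cases i <;> fin_cases j <;> simp [Matrix.charmatrix_apply]
  rw [h, Matrix.charpoly, h2, Matrix.det_succ_row_zero]
  simp [Fin.sum_univ_succ, Matrix.det_fin_three, Fin.succAbove]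
  ring

theorem RX_add_aux (x : ℝ) : (Real.cos x : ℂ) + -I * (Real.sin x : ℂ) = Complex.exp (-(x * I)) := by
  rw [← neg_mul, Complex.exp_mul_I, Complex.cos_neg, Complex.sin_neg]
  push_cast
  ring

theorem RX_sub_aux (x : ℝ) : (Real.cos x : ℂ) - -I * (Real.sin x : ℂ) = Complex.exp (x * I) := by
  rw [Complex.exp_mul_I]
  push_cast
  ring

theorem log_exp_aux (x : ℝ) (h1 : -1 ≤ x) (h2 : x ≤ 1) :
    Complex.log (Complex.exp ((x : ℂ) * I)) = x * I := by
  have := Real.pi_gt_three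
  apply Complex.log_exp <;> simp <;> linarith

theorem entropy_aux (x : ℝ) (h1 : -1 ≤ x) (h2 : x ≤ 1) :
    Complex.exp ((x : ℂ) * I) * Complex.log (Complex.exp ((x : ℂ) * I)) +
      Complex.exp (-(x : ℂ) * I) * Complex.log (Complex.exp (-(x : ℂ) * I)) =
      -(2 * x * Complex.sin x) := by
  have h := log_exp_aux (-x) (by linarith) (by linarith)
  rw [Complex.ofReal_neg] at h
  rw [h, log_exp_aux x h1 h2, Complex.exp_mul_I, Complex.exp_mul_I, Complex.cos_neg,
    Complex.sin_neg]
  linear_combination (2 * x * Complex.sin x) * Complex.I_sq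

/-- With `c = cos(2θ)`, the Kronecker product `R_X(2cos²θ) ⊗ R_X(2sin²θ)` has
characteristic polynomial `(X - e^{i})(X - e^{-i})(X - e^{ic})(X - e^{-ic})`, and the
pseudo-entropy over these four eigenvalues equals `2 cos(2θ) sin(cos(2θ)) + 2 sin 1`. -/
theorem angle_encoding_charpoly_pseudoEntropy (θ : ℝ) (c : ℝ) (hc : c = Real.cos (2 * θ)) :
    (RX (2 * Real.cos θ ^ 2) ⊗ₖ RX (2 * Real.sin θ ^ 2)).charpoly =
      (X - C (Complex.exp I)) * (X - C (Complex.exp (-I))) *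
        (X - C (Complex.exp ((c : ℂ) * I))) * (X - C (Complex.exp (-(c : ℂ) * I))) ∧
    -(Complex.exp ((c : ℂ) * I) * Complex.log (Complex.exp ((c : ℂ) * I)) +
        Complex.exp (-(c : ℂ) * I) * Complex.log (Complex.exp (-(c : ℂ) * I)) +
        Complex.exp I * Complex.log (Complex.exp I) +
        Complex.exp (-I) * Complex.log (Complex.exp (-I))) =
      ((2 * c * Real.sin c + 2 * Real.sin 1 : ℝ) : ℂ) := by
  constructor
  · have e1 : (2 * Real.cos θ ^ 2) / 2 = Real.cos θ ^ 2 := by ring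
    have e2 : (2 * Real.sin θ ^ 2) / 2 = Real.sin θ ^ 2 := by ring
    have s1 : ((Real.cos θ ^ 2 : ℝ) : ℂ) + ((Real.sin θ ^ 2 : ℝ) : ℂ) = 1 := by
      rw [← Complex.ofReal_add, Real.cos_sq_add_sin_sq, Complex.ofReal_one]
    have s2 : (c : ℂ) = ((Real.cos θ ^ 2 : ℝ) : ℂ) - ((Real.sin θ ^ 2 : ℝ) : ℂ) := by
      rw [← Complex.ofReal_sub, hc, Real.cos_two_mul']
    unfold RX
    rw [e1, e2, charpoly_kron_aux]
    simp only [RX_add_aux, RX_sub_aux, ← Complex.exp_add]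
    congr 5
    · congr 4
      linear_combination I * s1
    · congr 2
      linear_combination (-I) * s1
    · linear_combination (-I) * s2
    · linear_combination I * s2
  · have k1 := entropy_aux c (hc ▸ Real.neg_one_le_cos _) (hc ▸ Real.cos_le_one _)
    have k2 := entropy_aux 1 (by norm_num) le_rfl
    simp only [Complex.ofReal_one, one_mul, neg_mul] at k2
    push_cast
    linear_combination -k1 - k2
end

section
/- For every θ ∈ ℝ, there is no 2×2 unitary matrix U such that diag(1, −e^{iθ}) = U · diag(1, e^{iθ}) · Uᴴ. Equivalently, writing p(θ) = diag(1, e^{iθ}) for the phase gate, p(θ+π) is never unitarily conjugate to p(θ). -/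
open Matrix Complex

/-- For every real `θ`, there is no 2×2 unitary `U` with
`diag(1, -e^{iθ}) = U · diag(1, e^{iθ}) · Uᴴ`: the phase gate `p(θ+π)` is never
unitarily conjugate to the phase gate `p(θ)`. -/
theorem phaseGate_not_unitarily_conjugate (θ : ℝ) :
    ¬ ∃ U : Matrix (Fin 2) (Fin 2) ℂ, U * Uᴴ = 1 ∧
      Matrix.diagonal ![1, -Complex.exp ((θ : ℂ) * I)] =
        U * Matrix.diagonal ![1, Complex.exp ((θ : ℂ) * I)] * Uᴴ := by
  rintro ⟨U, hU, h⟩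
  have hU' : Uᴴ * U = 1 := mul_eq_one_comm.mp hU
  have ht := congrArg Matrix.trace h
  rw [Matrix.trace_mul_comm, ← Matrix.mul_assoc, hU', Matrix.one_mul] at ht
  simp only [Matrix.trace_diagonal, Fin.sum_univ_two, Matrix.cons_val_zero,
    Matrix.cons_val_one] at ht
  apply Complex.exp_ne_zero ((θ : ℂ) * I)
  linear_combination (-1 / 2 : ℂ) * ht
end
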